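/- Let κ > 0, δ > 0, t > 0, and α ∈ (κ/(κ+1), 1). Let μ_t^α be the α-stable subordinator law with Laplace transform e^{-t x^α}. Then there exists c > 0 depending only on α and κ such that ∫_0^∞ e^{δ/s^κ} μ_t^α(ds) ≤ 1 + (exp((c δ t^{−κ/α})^{1/(κ(1−1/α)+1)}) − 1)^{κ(1−1/α)+1} ≤ 2 exp((κ(1−1/α)+1)(c δ t^{−κ/α})^{1/(κ(1−1/α)+1)}). -/

import Mathlib

open MeasureTheory Real Set

/-- Ratios of Gamma values, from log-convexity: the slope of `log Γ` between `p` and `q` is at most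
its slope `log q` between `q` and `q + 1`. -/
theorem Gamma_le_rpow_mul_Gamma {p q : ℝ} (hp : 0 < p) (hpq : p < q) :
    Gamma q ≤ q ^ (q - p) * Gamma p := by
  have hq : 0 < q := hp.trans hpq
  have hΓp := Gamma_pos_of_pos hp
  have hΓq := Gamma_pos_of_pos hq
  have h := convexOn_log_Gamma.slope_mono_adjacent (x := p) (y := q) (z := q + 1)
    hp (by simp only [mem_Ioi]; linarith) hpq (by linarith)
  simp only [Function.comp_apply, Gamma_add_one hq.ne', log_mul hq.ne' hΓq.ne',
    add_sub_cancel_left, add_sub_cancel_right, div_one] at h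
  rw [div_le_iff₀ (by linarith)] at h
  rw [← log_le_log_iff hΓq (by positivity), log_mul (by positivity) hΓp.ne', log_rpow hq]
  linarith

theorem natCast_pow_self_le_exp_mul_factorial (n : ℕ) :
    (n : ℝ) ^ n ≤ exp 1 ^ n * n.factorial := by
  have h := pow_div_factorial_le_exp (n : ℝ) n.cast_nonneg n
  rwa [div_le_iff₀ (by positivity), ← exp_one_pow] at h

/-- Stirling-type bound for the coefficients of the series of negative moments. -/
theorem Gamma_ratio_le {κ α : ℝ} (hκ : 0 < κ) (hα : 0 < α) (hα1 : α < 1) {n : ℕ} (hn : n ≠ 0) :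
    1 / α * Gamma (κ * n / α) / Gamma (κ * n) ≤
      (1 / α * (exp 1 * (κ / α)) ^ (κ * (1 / α - 1))) ^ n *
        (n.factorial : ℝ) ^ (κ * (1 / α - 1)) := by
  have hn' : (0:ℝ) < n := by positivity
  have ha : 1 < 1 / α := (one_lt_div hα).mpr hα1
  set a : ℝ := κ * (1 / α - 1) with ha_def
  have ha0 : 0 ≤ a := mul_nonneg hκ.le (by linarith)
  have hΓ : 0 < Gamma (κ * n) := Gamma_pos_of_pos (by positivity)
  have hlt : κ * n < κ * n / α := by
    rw [div_eq_mul_one_div]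
    exact lt_mul_of_one_lt_right (by positivity) ha
  have hG := Gamma_le_rpow_mul_Gamma (by positivity) hlt
  have hpow : (κ * n / α) ^ (κ * n / α - κ * n) = ((κ / α) ^ n * (n : ℝ) ^ n) ^ a := by
    rw [← mul_pow, ← rpow_natCast, ← rpow_mul (by positivity)]
    congr 1
    · ring
    · rw [ha_def]; ring
  calc 1 / α * Gamma (κ * n / α) / Gamma (κ * n)
      ≤ 1 / α * ((κ / α) ^ n * (n : ℝ) ^ n) ^ a := by
        rw [div_le_iff₀ hΓ, mul_assoc, ← hpow]
        gcongr
    _ ≤ (1 / α) ^ n * ((κ / α) ^ n * (exp 1 ^ n * n.factorial)) ^ a := by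
        gcongr
        · exact le_self_pow₀ ha.le hn
        · exact natCast_pow_self_le_exp_mul_factorial n
    _ = (1 / α * (exp 1 * (κ / α)) ^ a) ^ n * (n.factorial : ℝ) ^ a := by
        rw [mul_pow, rpow_pow_comm (by positivity), mul_assoc,
          ← mul_rpow (by positivity) (by positivity), mul_pow]
        congr 2
        ring

/-- Negative moments of a law on `[0, ∞)` with a stable Laplace transform. -/
theorem lintegral_rpow_neg_le {α t p : ℝ} (hα : 0 < α) (ht : 0 < t) (hp : 0 < p)
    {μ : Measure ℝ} [IsProbabilityMeasure μ]
    (hμ : ∀ x : ℝ, 0 ≤ x →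
      ∫ s in Ici (0:ℝ), exp (-(x * s)) ∂μ = exp (-(t * x ^ α))) :
    ∫⁻ s in Ioi (0:ℝ), ENNReal.ofReal (s ^ (-p)) ∂μ ≤
      ENNReal.ofReal (t ^ (-(p / α)) * (1 / α * Gamma (p / α) / Gamma p)) := by
  have hΓ := Gamma_pos_of_pos hp
  have hgamma : ∀ s ∈ Ioi (0:ℝ), ENNReal.ofReal (s ^ (-p)) =
      (ENNReal.ofReal (Gamma p))⁻¹ *
        ∫⁻ x in Ioi (0:ℝ), ENNReal.ofReal (x ^ (p - 1) * exp (-(s * x))) := by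
    intro s hs
    have hs' : 0 < s := hs
    rw [← ofReal_integral_eq_lintegral_ofReal, integral_rpow_mul_exp_neg_mul_Ioi hp hs',
      ← ENNReal.ofReal_inv_of_pos hΓ, ← ENNReal.ofReal_mul (by positivity), one_div,
      inv_rpow hs'.le, rpow_neg hs'.le]
    · congr 1
      field_simp
    · simpa [IntegrableOn] using integrableOn_rpow_mul_exp_neg_mul_rpow (p := 1) (s := p - 1)
        (by linarith) one_pos hs'
    · filter_upwards [ae_restrict_mem measurableSet_Ioi] with x hx
      have : 0 < x := hx
      simp only [Pi.zero_apply]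
      positivity
  have hlaplace : ∀ x ∈ Ioi (0:ℝ),
      ∫⁻ s in Ioi (0:ℝ), ENNReal.ofReal (x ^ (p - 1) * exp (-(s * x))) ∂μ ≤
        ENNReal.ofReal (x ^ (p - 1) * exp (-t * x ^ α)) := by
    intro x hx
    have hx' : 0 < x := hx
    have hint : Integrable (fun s => exp (-(x * s))) (μ.restrict (Ici (0:ℝ))) := by
      refine (integrable_const (1:ℝ)).mono' (by fun_prop) ?_
      filter_upwards [ae_restrict_mem measurableSet_Ici] with s hs
      have : 0 ≤ s := hs
      rw [norm_of_nonneg (exp_pos _).le, exp_le_one_iff, neg_nonpos]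
      positivity
    calc ∫⁻ s in Ioi (0:ℝ), ENNReal.ofReal (x ^ (p - 1) * exp (-(s * x))) ∂μ
        ≤ ∫⁻ s in Ici (0:ℝ), ENNReal.ofReal (x ^ (p - 1) * exp (-(s * x))) ∂μ :=
          lintegral_mono_set Ioi_subset_Ici_self
      _ = ENNReal.ofReal (x ^ (p - 1)) *
            ∫⁻ s in Ici (0:ℝ), ENNReal.ofReal (exp (-(x * s))) ∂μ := by
          rw [← lintegral_const_mul _ (by fun_prop)]
          refine lintegral_congr fun s => ?_
          rw [ENNReal.ofReal_mul (by positivity), mul_comm s x]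
      _ = ENNReal.ofReal (x ^ (p - 1) * exp (-t * x ^ α)) := by
          rw [← ofReal_integral_eq_lintegral_ofReal hint (ae_of_all _ fun _ => (exp_pos _).le),
            hμ x hx'.le, ← ENNReal.ofReal_mul (by positivity), neg_mul]
  calc ∫⁻ s in Ioi (0:ℝ), ENNReal.ofReal (s ^ (-p)) ∂μ
      = (ENNReal.ofReal (Gamma p))⁻¹ * ∫⁻ s in Ioi (0:ℝ), (∫⁻ x in Ioi (0:ℝ),
          ENNReal.ofReal (x ^ (p - 1) * exp (-(s * x)))) ∂μ := by
        rw [← lintegral_const_mul' _ _ (by simpa using hΓ)]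
        exact setLIntegral_congr_fun measurableSet_Ioi hgamma
    _ = (ENNReal.ofReal (Gamma p))⁻¹ * ∫⁻ x in Ioi (0:ℝ), ∫⁻ s in Ioi (0:ℝ),
          ENNReal.ofReal (x ^ (p - 1) * exp (-(s * x))) ∂μ := by
        rw [lintegral_lintegral_swap (by fun_prop)]
    _ ≤ (ENNReal.ofReal (Gamma p))⁻¹ * ∫⁻ x in Ioi (0:ℝ),
          ENNReal.ofReal (x ^ (p - 1) * exp (-t * x ^ α)) := by
        gcongr 1
        exact setLIntegral_mono' measurableSet_Ioi hlaplace
    _ = ENNReal.ofReal (t ^ (-(p / α)) * (1 / α * Gamma (p / α) / Gamma p)) := by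
        rw [← ofReal_integral_eq_lintegral_ofReal
            (integrableOn_rpow_mul_exp_neg_mul_rpow (by linarith) hα ht),
          integral_rpow_mul_exp_neg_mul_rpow hα (by linarith) ht,
          ← ENNReal.ofReal_inv_of_pos hΓ, ← ENNReal.ofReal_mul (by positivity),
          sub_add_cancel, neg_div]
        · congr 1
          ring
        · filter_upwards [ae_restrict_mem measurableSet_Ioi] with x hx
          have : 0 < x := hx
          simp only [Pi.zero_apply]
          positivity

/-- Jensen's inequality (in Hölder form) for a Mittag-Leffler-type series. -/
theorem tsum_pow_div_factorial_rpow_le {ρ v : ℝ} (hρ : 0 < ρ) (hρ1 : ρ < 1) (hv : 0 ≤ v) :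
    (Summable fun n : ℕ =>
        ((1 / 2 : ℝ) ^ (1 - ρ) * v ^ ρ) ^ (n + 1) / ((n + 1).factorial : ℝ) ^ ρ) ∧
      ∑' n : ℕ, ((1 / 2 : ℝ) ^ (1 - ρ) * v ^ ρ) ^ (n + 1) / ((n + 1).factorial : ℝ) ^ ρ ≤
        (exp v - 1) ^ ρ := by
  have hexp : HasSum (fun n : ℕ => v ^ (n + 1) / ((n + 1).factorial : ℝ)) (exp v - 1) := by
    have h := NormedSpace.expSeries_div_hasSum_exp v
    rw [← exp_eq_exp_ℝ] at h
    simpa using (hasSum_nat_add_iff' 1).mpr h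
  have hgeom : HasSum (fun n : ℕ => (1 / 2 : ℝ) ^ (n + 1)) 1 := by
    convert hasSum_geometric_two' 1 using 2 with n
    rw [pow_succ, one_div_pow]
    ring
  have hconj : (1 - ρ)⁻¹.HolderConjugate ρ⁻¹ :=
    HolderConjugate.inv_inv (by linarith) hρ (by ring)
  have hf : ∀ n : ℕ, (((1 / 2 : ℝ) ^ (n + 1)) ^ (1 - ρ)) ^ (1 - ρ)⁻¹ = (1 / 2 : ℝ) ^ (n + 1) :=
    fun n => rpow_rpow_inv (by positivity) (by linarith)
  have hg : ∀ n : ℕ, ((v ^ (n + 1) / ((n + 1).factorial : ℝ)) ^ ρ) ^ ρ⁻¹ =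
      v ^ (n + 1) / ((n + 1).factorial : ℝ) :=
    fun n => rpow_rpow_inv (by positivity) hρ.ne'
  have hterm : ∀ n : ℕ,
      ((1 / 2 : ℝ) ^ (1 - ρ) * v ^ ρ) ^ (n + 1) / ((n + 1).factorial : ℝ) ^ ρ =
        ((1 / 2 : ℝ) ^ (n + 1)) ^ (1 - ρ) * (v ^ (n + 1) / ((n + 1).factorial : ℝ)) ^ ρ := by
    intro n
    rw [mul_pow, div_rpow (pow_nonneg hv _) (by positivity), rpow_pow_comm (by positivity),
      rpow_pow_comm hv, mul_div_assoc]
  simp only [hterm]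
  have hfs : Summable fun n : ℕ => (((1 / 2 : ℝ) ^ (n + 1)) ^ (1 - ρ)) ^ (1 - ρ)⁻¹ := by
    simpa only [hf] using hgeom.summable
  have hgs : Summable fun n : ℕ => ((v ^ (n + 1) / ((n + 1).factorial : ℝ)) ^ ρ) ^ ρ⁻¹ := by
    simpa only [hg] using hexp.summable
  have h := inner_le_Lp_mul_Lq_tsum_of_nonneg hconj (fun n => by positivity)
    (fun n => by positivity) hfs hgs
  refine ⟨summable_mul_of_Lp_Lq_of_nonneg hconj (fun n => by positivity)
    (fun n => by positivity) hfs hgs, h.trans_eq ?_⟩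
  simp only [hf, hg]
  rw [hgeom.tsum_eq, hexp.tsum_eq, one_rpow, one_mul, one_div, inv_inv]

/-- An exponential moment of a negative power is controlled by the negative moments. -/
theorem integral_exp_div_rpow_le {κ δ S : ℝ} (hδ : 0 < δ) {μ : Measure ℝ}
    [IsProbabilityMeasure μ] {b : ℕ → ℝ} (hb : ∀ n, 0 ≤ b n) (hbs : Summable b)
    (hS : ∑' n, b n ≤ S)
    (hmom : ∀ n : ℕ, ENNReal.ofReal (δ ^ (n + 1) / (n + 1).factorial) *
      ∫⁻ s in Ioi (0:ℝ), ENNReal.ofReal (s ^ (-(κ * (n + 1 : ℕ)))) ∂μ ≤ ENNReal.ofReal (b n)) :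
    ∫ s in Ioi (0:ℝ), exp (δ / s ^ κ) ∂μ ≤ 1 + S := by
  have hS0 : 0 ≤ S := (tsum_nonneg hb).trans hS
  have hexp : ∀ s ∈ Ioi (0:ℝ), ENNReal.ofReal (exp (δ / s ^ κ)) =
      ∑' n : ℕ, ENNReal.ofReal (δ ^ n / n.factorial) * ENNReal.ofReal (s ^ (-(κ * n))) := by
    intro s hs
    have hs' : 0 < s := hs
    have h := NormedSpace.expSeries_div_hasSum_exp (δ / s ^ κ)
    rw [← exp_eq_exp_ℝ] at h
    rw [← h.tsum_eq, ENNReal.ofReal_tsum_of_nonneg (fun n => by positivity) h.summable]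
    refine tsum_congr fun n => ?_
    rw [← ENNReal.ofReal_mul (by positivity), rpow_neg hs'.le, rpow_mul hs'.le, rpow_natCast,
      div_pow]
    congr 1
    ring
  rw [integral_eq_lintegral_of_nonneg_ae (ae_of_all _ fun _ => (exp_pos _).le)
    (by fun_prop : Measurable fun s : ℝ => exp (δ / s ^ κ)).aestronglyMeasurable]
  refine ENNReal.toReal_le_of_le_ofReal (by linarith) ?_
  rw [setLIntegral_congr_fun measurableSet_Ioi hexp, lintegral_tsum (fun n => by fun_prop),
    tsum_eq_zero_add' ENNReal.summable, ENNReal.ofReal_add zero_le_one hS0]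
  refine add_le_add ?_ ?_
  · simpa using prob_le_one
  · refine le_trans (ENNReal.tsum_le_tsum fun n => ?_)
      ((ENNReal.ofReal_tsum_of_nonneg hb hbs).symm.trans_le (ENNReal.ofReal_le_ofReal hS))
    rw [lintegral_const_mul _ (by fun_prop)]
    exact hmom n

theorem one_add_exp_sub_one_rpow_le {ρ v : ℝ} (hρ : 0 < ρ) (hv : 0 ≤ v) :
    1 + (exp v - 1) ^ ρ ≤ 2 * exp (ρ * v) := by
  have h0 : 0 ≤ exp v - 1 := by linarith [one_le_exp hv]
  have h1 : (exp v - 1) ^ ρ ≤ exp v ^ ρ := rpow_le_rpow h0 (by linarith) hρ.le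
  rw [← exp_mul, mul_comm v] at h1
  linarith [one_le_exp (mul_nonneg hρ.le hv)]

theorem stmt_12 (κ α : ℝ) (hκ : 0 < κ) (hα1 : κ / (κ + 1) < α) (hα2 : α < 1) :
    ∃ c : ℝ, 0 < c ∧ ∀ (δ t : ℝ), 0 < δ → 0 < t →
      ∀ (μ : Measure ℝ), IsProbabilityMeasure μ → μ (Iio (0:ℝ)) = 0 →
      (∀ x : ℝ, 0 ≤ x →
        ∫ s in Ici (0:ℝ), Real.exp (-(x * s)) ∂μ = Real.exp (-(t * x ^ α))) →
      (∫ s in Ioi (0:ℝ), Real.exp (δ / s ^ κ) ∂μ ≤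
        1 + (Real.exp ((c * δ * t ^ (-(κ / α))) ^ (1 / (κ * (1 - 1 / α) + 1))) - 1) ^
            (κ * (1 - 1 / α) + 1)
        ∧
        1 + (Real.exp ((c * δ * t ^ (-(κ / α))) ^ (1 / (κ * (1 - 1 / α) + 1))) - 1) ^
            (κ * (1 - 1 / α) + 1) ≤
          2 * Real.exp ((κ * (1 - 1 / α) + 1) *
            (c * δ * t ^ (-(κ / α))) ^ (1 / (κ * (1 - 1 / α) + 1)))) := by
  have hα : 0 < α := lt_trans (by positivity) hα1
  set ρ : ℝ := κ * (1 - 1 / α) + 1 with hρ_def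
  have hρ : 0 < ρ := by
    have h : κ < α * (κ + 1) := (div_lt_iff₀ (by linarith)).mp hα1
    have : ρ = (α * (κ + 1) - κ) / α := by rw [hρ_def]; field_simp; ring
    rw [this]
    exact div_pos (by linarith) hα
  have hρ1 : ρ < 1 := by
    have : 1 < 1 / α := (one_lt_div hα).mpr hα2
    nlinarith
  have hρκ : κ * (1 / α - 1) = 1 - ρ := by rw [hρ_def]; ring
  set C : ℝ := 1 / α * (exp 1 * (κ / α)) ^ (1 - ρ) with hC_def
  have hC : 0 < C := by positivity
  clear_value C
  refine ⟨2 ^ (1 - ρ) * C, by positivity, fun δ t hδ ht μ _ _ hμ => ?_⟩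
  set y : ℝ := 2 ^ (1 - ρ) * C * δ * t ^ (-(κ / α)) with hy_def
  have hy : 0 < y := by positivity
  refine ⟨?_, one_add_exp_sub_one_rpow_le hρ (by positivity)⟩
  obtain ⟨hsum, hle⟩ := tsum_pow_div_factorial_rpow_le (v := y ^ (1 / ρ)) hρ hρ1 (by positivity)
  refine integral_exp_div_rpow_le hδ (fun n => by positivity) hsum hle fun n => ?_
  have hy2 : (1 / 2 : ℝ) ^ (1 - ρ) * (y ^ (1 / ρ)) ^ ρ = C * δ * t ^ (-(κ / α)) := by
    rw [one_div ρ, rpow_inv_rpow hy.le hρ.ne', hy_def, one_div, inv_rpow zero_le_two]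
    field_simp
  rw [hy2]
  set m := n + 1
  have hm : m ≠ 0 := n.succ_ne_zero
  refine (mul_le_mul_right (lintegral_rpow_neg_le hα ht (by positivity) hμ) _).trans ?_
  rw [← ENNReal.ofReal_mul (by positivity)]
  refine ENNReal.ofReal_le_ofReal ?_
  have hratio := Gamma_ratio_le hκ hα hα2 hm
  rw [hρκ, ← hC_def] at hratio
  have hfac : (0:ℝ) < m.factorial := by positivity
  have htm : t ^ (-(κ * m / α)) = (t ^ (-(κ / α))) ^ m := by
    rw [← rpow_natCast, ← rpow_mul ht.le]
    congr 1
    ring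
  calc δ ^ m / m.factorial *
        (t ^ (-(κ * m / α)) * (1 / α * Gamma (κ * m / α) / Gamma (κ * m)))
      ≤ δ ^ m / m.factorial *
        (t ^ (-(κ * m / α)) * (C ^ m * (m.factorial : ℝ) ^ (1 - ρ))) := by gcongr
    _ = (C * δ * t ^ (-(κ / α))) ^ m / (m.factorial : ℝ) ^ ρ := by
        rw [htm, rpow_sub hfac, rpow_one, mul_pow, mul_pow]
        field_simp
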